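/- Let d be an admissible sequence and a an admissible family. Then for every real s > 0 the series F₁(s) = Σ_{n∈ℤ} Σ_{m≥0} c^{2n+m} q^{n-m/2} d_m a(n,m) · Σ_{l≥l₁} (cα)^l q^{l/2} (q^{s(|n+m+l|+|n+l|)} - q^{s(|n+m|+|n|)}) converges absolutely, and lim_{s→0⁺} s·F₁(s) = 0. -/

import Mathlib

open Filter Topology

noncomputable section

/-- `qc q x` is the real power `q ^ x`, viewed as a complex number. -/
def qc (q : ℝ) (x : ℝ) : ℂ := ((q ^ x : ℝ) : ℂ)

/-- An admissible sequence: `d m = q^(m/2) (c₁ c^m + c₂ c^(-m))` for all `m ≥ l₁`. -/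
def IsAdmissibleSeq (q : ℝ) (c : ℂ) (l₁ : ℤ) (d : ℕ → ℂ) : Prop :=
  ∃ c₁ c₂ : ℂ, ∀ m : ℕ, l₁ ≤ (m : ℤ) →
    d m = qc q ((m : ℝ) / 2) * (c₁ * c ^ (m : ℤ) + c₂ * c ^ (-(m : ℤ)))

/-- An admissible family on `ℤ × ℕ`, given by region asymptotics. -/
def IsAdmissibleFam (q : ℝ) (l₁ : ℤ) (a : ℤ → ℕ → ℂ) : Prop :=
  ∃ (k₁ k₂ k₃ : ℂ) (A B : ℤ → ℂ), ∀ (n : ℤ) (m : ℕ),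
    (l₁ ≤ n → a n m = k₁) ∧
    (-l₁ < n → n < l₁ → l₁ ≤ n + (m : ℤ) → a n m = A n) ∧
    (n ≤ -l₁ → l₁ ≤ n + (m : ℤ) → a n m = qc q (-(n : ℝ)) * k₂) ∧
    (n ≤ -l₁ → -l₁ < n + (m : ℤ) → n + (m : ℤ) < l₁ →
      a n m = qc q (-(n : ℝ)) * B (n + m)) ∧
    (n + (m : ℤ) ≤ -l₁ → a n m = qc q (-(2 * (n : ℝ) + (m : ℝ))) * k₃)

/-- An `l`-stabilized family on `ℤ × ℕ` (the regions do not depend on `l`). -/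
def IsStabilizedFam (q : ℝ) (c : ℂ) (l₁ : ℤ) (e : ℤ → ℕ → ℂ) : Prop :=
  ∃ (u w : ℂ) (f v : ℤ → ℂ) (N : ℤ), 2 * l₁ < N ∧ ∀ (n : ℤ) (m : ℕ),
    (l₁ ≤ n → e n m = (c ^ 2 * (q : ℂ)) ^ n * (c * qc q (1 / 2)) ^ m * u) ∧
    (-l₁ < n → n < l₁ → N ≤ (m : ℤ) → e n m = (c * qc q (1 / 2)) ^ m * f n) ∧
    (n ≤ -l₁ → -l₁ < n + (m : ℤ) → n + (m : ℤ) < l₁ → N ≤ (m : ℤ) →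
      e n m = qc q ((m : ℝ) / 2) * c ^ (-(m : ℤ)) * v (n + m)) ∧
    (n + (m : ℤ) ≤ -l₁ → e n m = (c ^ 2 * (q : ℂ)⁻¹) ^ n * (c * qc q (-(1 / 2))) ^ m * w)

/-- A real function is bounded above on a finite set, by a nonnegative constant. -/
lemma exists_nonneg_bound_of_finite {ι : Type*} {S : Set ι} (hS : S.Finite) (f : ι → ℝ) :
    ∃ C : ℝ, 0 ≤ C ∧ ∀ x ∈ S, f x ≤ C := by
  obtain ⟨C, hC⟩ := (hS.image f).bddAbove
  exact ⟨max C 0, le_max_right _ _,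
    fun x hx => (hC (Set.mem_image_of_mem f hx)).trans (le_max_left _ _)⟩

lemma norm_qc {q : ℝ} (hq0 : 0 < q) (x : ℝ) : ‖qc q x‖ = q ^ x := by
  rw [qc, Complex.norm_real, Real.norm_of_nonneg (Real.rpow_nonneg hq0.le x)]

lemma IsAdmissibleSeq.exists_bound {q : ℝ} (hq0 : 0 < q) {c : ℂ} (hc : ‖c‖ = 1) {l₁ : ℤ}
    {d : ℕ → ℂ} (hd : IsAdmissibleSeq q c l₁ d) :
    ∃ C : ℝ, 0 ≤ C ∧ ∀ m : ℕ, ‖d m‖ ≤ C * q ^ ((m : ℝ) / 2) := by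
  obtain ⟨c₁, c₂, h⟩ := hd
  have hfin : {m : ℕ | (m : ℤ) < l₁}.Finite :=
    (Set.finite_Iio l₁.toNat).subset fun m (hm : (m : ℤ) < l₁) => by
      simp only [Set.mem_Iio]; omega
  obtain ⟨C, hC0, hC⟩ := exists_nonneg_bound_of_finite hfin
    fun m => ‖d m‖ / q ^ ((m : ℝ) / 2)
  refine ⟨C + (‖c₁‖ + ‖c₂‖), by positivity, fun m => ?_⟩
  have hpos : 0 < q ^ ((m : ℝ) / 2) := Real.rpow_pos_of_pos hq0 _
  rcases lt_or_ge (m : ℤ) l₁ with hm | hm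
  · have := (div_le_iff₀ hpos).1 (hC m hm)
    refine this.trans (mul_le_mul_of_nonneg_right ?_ hpos.le)
    linarith [norm_nonneg c₁, norm_nonneg c₂]
  · rw [h m hm, norm_mul, norm_qc hq0, mul_comm]
    refine mul_le_mul_of_nonneg_right ?_ hpos.le
    have h1 : ‖c₁ * c ^ (m : ℤ) + c₂ * c ^ (-(m : ℤ))‖ ≤ ‖c₁‖ + ‖c₂‖ := by
      refine (norm_add_le _ _).trans (le_of_eq ?_)
      simp [hc]
    linarith

lemma IsAdmissibleFam.exists_bound {q : ℝ} (hq0 : 0 < q) {l₁ : ℤ} (hl₁ : 0 < l₁)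
    {a : ℤ → ℕ → ℂ} (ha : IsAdmissibleFam q l₁ a) :
    ∃ C : ℝ, 0 ≤ C ∧ ∀ (n : ℤ) (m : ℕ),
      q ^ (n : ℝ) * ‖a n m‖ ≤ C * q ^ (max (n : ℝ) 0 + max (-((n : ℝ) + m)) 0) := by
  obtain ⟨k₁, k₂, k₃, A, B, h⟩ := ha
  obtain ⟨CA, hCA0, hCA⟩ := exists_nonneg_bound_of_finite (Set.finite_Ioo (-l₁) l₁)
    fun n => ‖A n‖ * q ^ ((n : ℝ) - max (n : ℝ) 0)
  obtain ⟨CB, hCB0, hCB⟩ := exists_nonneg_bound_of_finite (Set.finite_Ioo (-l₁) l₁)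
    fun p => ‖B p‖ * q ^ (-max (-(p : ℝ)) 0)
  obtain ⟨CE, hCE0, hCE⟩ := exists_nonneg_bound_of_finite
    ((Set.finite_Ioo (-l₁) l₁).prod (Set.finite_Iio (2 * l₁).toNat))
    fun x => ‖a x.1 x.2‖ * q ^ ((x.1 : ℝ) - (max (x.1 : ℝ) 0 + max (-((x.1 : ℝ) + x.2)) 0))
  refine ⟨CA + CB + CE + ‖k₁‖ + ‖k₂‖ + ‖k₃‖, by positivity, fun n m => ?_⟩
  have n1 := norm_nonneg k₁
  have n2 := norm_nonneg k₂
  have n3 := norm_nonneg k₃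
  set e : ℝ := max (n : ℝ) 0 + max (-((n : ℝ) + m)) 0 with he
  suffices hs : ‖a n m‖ * q ^ ((n : ℝ) - e) ≤ CA + CB + CE + ‖k₁‖ + ‖k₂‖ + ‖k₃‖ by
    have hpos : 0 < q ^ e := Real.rpow_pos_of_pos hq0 _
    calc q ^ (n : ℝ) * ‖a n m‖ = ‖a n m‖ * q ^ ((n : ℝ) - e) * q ^ e := by
          rw [mul_assoc, ← Real.rpow_add hq0]; ring_nf
      _ ≤ _ := mul_le_mul_of_nonneg_right hs hpos.le
  obtain ⟨h1, h2, h3, h4, h5⟩ := h n m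
  have hm : (0 : ℝ) ≤ m := Nat.cast_nonneg m
  have hl : (0 : ℝ) < l₁ := Int.cast_pos.2 hl₁
  rcases le_or_gt l₁ n with hn | hn
  · have hnR : (l₁ : ℝ) ≤ n := Int.cast_le.2 hn
    rw [h1 hn, he, max_eq_left (by linarith), max_eq_right (by linarith)]
    simp only [add_zero, sub_self, Real.rpow_zero, mul_one]
    linarith
  rcases le_or_gt n (-l₁) with hn' | hn'
  · have hnR : (n : ℝ) ≤ -l₁ := by exact_mod_cast hn'
    rcases le_or_gt l₁ (n + m) with hp | hp
    · have hpR : (l₁ : ℝ) ≤ n + m := by exact_mod_cast hp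
      rw [h3 hn' hp, he, max_eq_right (by linarith), max_eq_right (by linarith), norm_mul,
        norm_qc hq0, mul_right_comm, ← Real.rpow_add hq0]
      simp only [add_zero, sub_zero, neg_add_cancel, Real.rpow_zero, one_mul]
      linarith
    rcases le_or_gt (n + m) (-l₁) with hp' | hp'
    · have hpR : (n : ℝ) + m ≤ -l₁ := by exact_mod_cast hp'
      rw [h5 hp', he, max_eq_right (by linarith), max_eq_left (by linarith), norm_mul,
        norm_qc hq0, mul_right_comm, ← Real.rpow_add hq0]
      rw [show -(2 * (n : ℝ) + m) + (n - (0 + -((n : ℝ) + m))) = 0 by ring, Real.rpow_zero]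
      linarith
    · have hb := hCB (n + m) ⟨hp', hp⟩
      rw [h4 hn' hp' hp, he, max_eq_right (a := (n : ℝ)) (by linarith), norm_mul,
        norm_qc hq0, mul_right_comm, ← Real.rpow_add hq0]
      push_cast at hb
      rw [show -(n : ℝ) + (n - (0 + max (-((n : ℝ) + m)) 0)) = -max (-((n : ℝ) + m)) 0 by ring,
        mul_comm]
      linarith
  · rcases le_or_gt l₁ (n + m) with hp | hp
    · have hpR : (l₁ : ℝ) ≤ n + m := by exact_mod_cast hp
      have hb := hCA n ⟨hn', hn⟩
      rw [h2 hn' hn hp, he, max_eq_right (a := -((n : ℝ) + m)) (by linarith), add_zero]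
      linarith
    · have hb := hCE (n, m) ⟨⟨hn', hn⟩, by simp only [Set.mem_Iio]; omega⟩
      simp only [← he] at hb
      linarith

/-- The Lipschitz estimate for `x ↦ q ^ x` on `[y - t, ∞)`. -/
lemma abs_rpow_sub_rpow_le {q : ℝ} (hq0 : 0 < q) (hq1 : q < 1) {u v y t : ℝ}
    (hu : y - t ≤ u) (hv : y - t ≤ v) (huv : |u - v| ≤ t) :
    |q ^ u - q ^ v| ≤ -Real.log q * t * q ^ (y - t) := by
  wlog h : u ≤ v generalizing u v
  · rw [abs_sub_comm]
    exact this hv hu (by rwa [abs_sub_comm]) (le_of_not_ge h)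
  have hlog : 0 < -Real.log q := neg_pos.2 (Real.log_neg hq0 hq1)
  have h0 : 0 < q ^ u := Real.rpow_pos_of_pos hq0 _
  have h1 : q ^ u ≤ q ^ (y - t) := Real.rpow_le_rpow_of_exponent_ge hq0 hq1.le hu
  have h2 : v - u ≤ t := by rwa [abs_sub_comm, abs_of_nonneg (sub_nonneg.2 h)] at huv
  have h3 : q ^ v = q ^ u * q ^ (v - u) := by rw [← Real.rpow_add hq0]; ring_nf
  have h4 : Real.log q * (v - u) + 1 ≤ q ^ (v - u) := by
    rw [Real.rpow_def_of_pos hq0]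
    exact Real.add_one_le_exp _
  rw [abs_of_nonneg (sub_nonneg.2 (Real.rpow_le_rpow_of_exponent_ge hq0 hq1.le h)), h3]
  calc q ^ u - q ^ u * q ^ (v - u) = q ^ u * (1 - q ^ (v - u)) := by ring
    _ ≤ q ^ u * (-Real.log q * t) := by
        refine mul_le_mul_of_nonneg_left ?_ h0.le
        nlinarith [mul_le_mul_of_nonneg_left h2 hlog.le]
    _ ≤ q ^ (y - t) * (-Real.log q * t) :=
        mul_le_mul_of_nonneg_right h1 (mul_nonneg hlog.le (by linarith))
    _ = _ := by ring

lemma hasSum_rpow_mul_abs {q : ℝ} (hq0 : 0 < q) (hq1 : q < 1) {s : ℝ} (hs : 0 < s) :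
    HasSum (fun n : ℤ => q ^ (s * |(n : ℝ)|)) ((1 - q ^ s)⁻¹ + q ^ s * (1 - q ^ s)⁻¹) := by
  have hr0 : 0 ≤ q ^ s := Real.rpow_nonneg hq0.le _
  have hr1 : q ^ s < 1 := Real.rpow_lt_one hq0.le hq1 hs
  have hg := hasSum_geometric_of_lt_one hr0 hr1
  refine HasSum.of_nat_of_neg_add_one ?_ ?_
  · convert hg using 2 with n
    simp [Real.rpow_mul hq0.le, Real.rpow_natCast]
  · have hfun : (fun n : ℕ => q ^ (s * |((-((n : ℤ) + 1) : ℤ) : ℝ)|)) =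
        fun n : ℕ => q ^ s * (q ^ s) ^ n := by
      funext n
      have : |((-((n : ℤ) + 1) : ℤ) : ℝ)| = ((n + 1 : ℕ) : ℝ) := by
        push_cast
        rw [abs_neg, abs_of_nonneg (by positivity)]
      rw [this, Real.rpow_mul hq0.le, Real.rpow_natCast, pow_succ']
    rw [hfun]
    exact hg.mul_left (q ^ s)

lemma tsum_rpow_mul_abs_le {q : ℝ} (hq0 : 0 < q) (hq1 : q < 1) {s : ℝ} (hs : 0 < s)
    (hs1 : s ≤ 1) : ∑' n : ℤ, q ^ (s * |(n : ℝ)|) ≤ 2 / (s * (1 - q)) := by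
  have hr1 : q ^ s < 1 := Real.rpow_lt_one hq0.le hq1 hs
  have hb : q ^ s ≤ 1 + s * (q - 1) := by
    have := rpow_one_add_le_one_add_mul_self (s := q - 1) (by linarith) hs.le hs1
    rwa [add_sub_cancel] at this
  rw [(hasSum_rpow_mul_abs hq0 hq1 hs).tsum_eq]
  have hpos : 0 < s * (1 - q) := mul_pos hs (by linarith)
  calc (1 - q ^ s)⁻¹ + q ^ s * (1 - q ^ s)⁻¹ = (1 + q ^ s) / (1 - q ^ s) := by
        rw [div_eq_mul_inv]; ring
    _ ≤ 2 / (s * (1 - q)) := div_le_div₀ (by norm_num) (by linarith) hpos (by linarith)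

/-- Sums of products of summable functions over the half space `p ≥ n`, with `p = n + m`. -/
lemma summable_and_tsum_le_of_mul_shear {f g : ℤ → ℝ} {h : ℕ → ℝ} (hf : Summable f)
    (hg : Summable g) (hh : Summable h) (hf0 : 0 ≤ f) (hg0 : 0 ≤ g) (hh0 : 0 ≤ h) :
    (Summable fun x : ℤ × ℕ × ℕ => f x.1 * (g (x.1 + x.2.1) * h x.2.2)) ∧
      ∑' x : ℤ × ℕ × ℕ, f x.1 * (g (x.1 + x.2.1) * h x.2.2) ≤
        (∑' n, f n) * ((∑' p, g p) * ∑' j, h j) := by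
  have hgh : Summable fun y : ℤ × ℕ => g y.1 * h y.2 := hg.mul_of_nonneg hh hg0 hh0
  have hgh0 : (0 : ℤ × ℕ → ℝ) ≤ fun y => g y.1 * h y.2 := fun y => mul_nonneg (hg0 _) (hh0 _)
  have hall : Summable fun x : ℤ × ℤ × ℕ => f x.1 * (g x.2.1 * h x.2.2) :=
    hf.mul_of_nonneg hgh hf0 hgh0
  have hinj : Function.Injective fun x : ℤ × ℕ × ℕ => (x.1, x.1 + (x.2.1 : ℤ), x.2.2) := by
    rintro ⟨n, m, j⟩ ⟨n', m', j'⟩ hx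
    simp only [Prod.mk.injEq] at hx ⊢
    omega
  refine ⟨hall.comp_injective hinj, ?_⟩
  rw [hg.tsum_mul_tsum hh hgh, hf.tsum_mul_tsum hgh hall]
  exact tsum_comp_le_tsum_of_inj hall (fun x => mul_nonneg (hf0 _) (hgh0 x.2)) hinj

lemma summable_mul_rpow_div {q : ℝ} (hq0 : 0 < q) (hq1 : q < 1) (l : ℝ) :
    Summable fun j : ℕ => (l + j) * q ^ ((l + j) / 4) := by
  have hr1 : ‖q ^ (1 / 4 : ℝ)‖ < 1 := by
    rw [Real.norm_of_nonneg (Real.rpow_nonneg hq0.le _)]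
    exact Real.rpow_lt_one hq0.le hq1 (by norm_num)
  have h0 := (summable_geometric_of_norm_lt_one hr1).mul_left (l * q ^ (l / 4))
  have h1 := (summable_pow_mul_geometric_of_norm_lt_one 1 hr1).mul_left (q ^ (l / 4))
  refine (h0.add h1).congr fun j => ?_
  have : q ^ ((l + j) / 4) = q ^ (l / 4) * (q ^ (1 / 4 : ℝ)) ^ j := by
    rw [← Real.rpow_natCast, ← Real.rpow_mul hq0.le, ← Real.rpow_add hq0]
    ring_nf
  rw [this]
  ring

/-- The weight `q ^ (n⁺ + p⁻)` times the increment of the regulator decays in one of the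
directions `n`, `p`, since the increment vanishes for `n ≤ -l` and `0 ≤ p`. -/
lemma weight_mul_increment_le {q : ℝ} (hq0 : 0 < q) (hq1 : q < 1) {n p l s : ℝ} (hl : 0 ≤ l)
    (hs : 0 < s) (hs' : s ≤ 1 / 16) :
    q ^ (max n 0 + max (-p) 0) * (q ^ (l / 2) *
      |q ^ (s * (|p + l| + |n + l|)) - q ^ (s * (|p| + |n|))|) ≤
    s * (2 * -Real.log q) * (q ^ (1 / 8 * |n|) * (q ^ (s * |p|) * (l * q ^ (l / 4))) +
      q ^ (s * |n|) * (q ^ (1 / 8 * |p|) * (l * q ^ (l / 4)))) := by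
  have hlog : 0 < -Real.log q := neg_pos.2 (Real.log_neg hq0 hq1)
  have hmono : ∀ {x y : ℝ}, x ≤ y → q ^ y ≤ q ^ x := fun h =>
    Real.rpow_le_rpow_of_exponent_ge hq0 hq1.le h
  have hN : 0 ≤ max n 0 := le_max_right _ _
  have hQ : 0 ≤ max (-p) 0 := le_max_right _ _
  have hR : 0 ≤ s * (2 * -Real.log q) * l := by positivity
  have e1 : 0 ≤ q ^ (1 / 8 * |n|) * (q ^ (s * |p|) * q ^ (l / 4)) := by positivity
  have e2 : 0 ≤ q ^ (s * |n|) * (q ^ (1 / 8 * |p|) * q ^ (l / 4)) := by positivity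
  rw [show s * (2 * -Real.log q) * (q ^ (1 / 8 * |n|) * (q ^ (s * |p|) * (l * q ^ (l / 4))) +
      q ^ (s * |n|) * (q ^ (1 / 8 * |p|) * (l * q ^ (l / 4)))) =
      s * (2 * -Real.log q) * l * (q ^ (1 / 8 * |n|) * (q ^ (s * |p|) * q ^ (l / 4)) +
      q ^ (s * |n|) * (q ^ (1 / 8 * |p|) * q ^ (l / 4))) by ring]
  by_cases hc : n ≤ -l ∧ 0 ≤ p
  · have hz : |p + l| + |n + l| = |p| + |n| := by
      rw [abs_of_nonneg (by linarith [hc.2]), abs_of_nonpos (by linarith [hc.1]),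
        abs_of_nonneg hc.2, abs_of_nonpos (by linarith [hc.1])]
      ring
    rw [hz, sub_self, abs_zero, mul_zero, mul_zero]
    exact mul_nonneg hR (by linarith)
  have t1 : |p| - l ≤ |p + l| ∧ |p + l| ≤ |p| + l := by
    rw [← abs_of_nonneg hl]
    simpa using And.intro (abs_sub_abs_le_abs_sub p (-|l|)) (abs_add_le p |l|)
  have t2 : |n| - l ≤ |n + l| ∧ |n + l| ≤ |n| + l := by
    rw [← abs_of_nonneg hl]
    simpa using And.intro (abs_sub_abs_le_abs_sub n (-|l|)) (abs_add_le n |l|)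
  have hsl : 0 ≤ s * l := by positivity
  have hsl' : s * l ≤ 1 / 16 * l := mul_le_mul_of_nonneg_right hs' hl
  have hdiff := abs_rpow_sub_rpow_le hq0 hq1 (u := s * (|p + l| + |n + l|))
    (v := s * (|p| + |n|)) (y := s * (|p| + |n|)) (t := s * (2 * l))
    (by nlinarith) (by nlinarith) (by
      rw [← mul_sub, abs_mul, abs_of_pos hs]
      refine mul_le_mul_of_nonneg_left (abs_le.2 ⟨?_, ?_⟩) hs.le <;> linarith)
  have hw : q ^ (max n 0 + max (-p) 0 + l / 2 + (s * (|p| + |n|) - s * (2 * l))) ≤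
      q ^ (1 / 8 * |n|) * (q ^ (s * |p|) * q ^ (l / 4)) +
      q ^ (s * |n|) * (q ^ (1 / 8 * |p|) * q ^ (l / 4)) := by
    have sn : 0 ≤ s * |n| := by positivity
    have sp : 0 ≤ s * |p| := by positivity
    rcases not_and_or.1 hc with h | h
    · have : |n| ≤ 8 * max n 0 + l := by
        refine abs_le.2 ⟨?_, ?_⟩ <;> linarith [le_max_left n 0]
      refine le_trans ?_ (le_add_of_nonneg_right e2)
      rw [← Real.rpow_add hq0, ← Real.rpow_add hq0]
      exact hmono (by linarith)
    · have : |p| ≤ 8 * max (-p) 0 := by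
        rw [abs_of_neg (not_le.1 h)]; linarith [le_max_left (-p) 0]
      refine le_trans ?_ (le_add_of_nonneg_left e1)
      rw [← Real.rpow_add hq0, ← Real.rpow_add hq0]
      exact hmono (by linarith)
  calc q ^ (max n 0 + max (-p) 0) * (q ^ (l / 2) *
        |q ^ (s * (|p + l| + |n + l|)) - q ^ (s * (|p| + |n|))|)
      ≤ q ^ (max n 0 + max (-p) 0) * (q ^ (l / 2) *
        (-Real.log q * (s * (2 * l)) * q ^ (s * (|p| + |n|) - s * (2 * l)))) := by
        gcongr
    _ = s * (2 * -Real.log q) * l *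
        q ^ (max n 0 + max (-p) 0 + l / 2 + (s * (|p| + |n|) - s * (2 * l))) := by
        rw [Real.rpow_add hq0 _ (s * (|p| + |n|) - s * (2 * l)), Real.rpow_add hq0 _ (l / 2)]
        ring
    _ ≤ _ := mul_le_mul_of_nonneg_left hw hR

lemma increment_le_of_le {q : ℝ} (hq0 : 0 < q) (hq1 : q < 1) {n p l r s : ℝ} (hl : 0 ≤ l)
    (hr : 0 < r) (hr' : r ≤ 1 / 8) (hrs : r ≤ s) :
    q ^ (max n 0 + max (-p) 0) * (q ^ (l / 2) *
      |q ^ (s * (|p + l| + |n + l|)) - q ^ (s * (|p| + |n|))|) ≤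
    2 * (q ^ (r * |n|) * (q ^ (r * |p|) * q ^ (l / 4))) := by
  have hmono : ∀ {x y : ℝ}, x ≤ y → q ^ y ≤ q ^ x := fun h =>
    Real.rpow_le_rpow_of_exponent_ge hq0 hq1.le h
  have t1 : |p| - l ≤ |p + l| := by
    rw [← abs_of_nonneg hl]
    simpa using abs_sub_abs_le_abs_sub p (-|l|)
  have t2 : |n| - l ≤ |n + l| := by
    rw [← abs_of_nonneg hl]
    simpa using abs_sub_abs_le_abs_sub n (-|l|)
  have hrl : r * l ≤ 1 / 8 * l := mul_le_mul_of_nonneg_right hr' hl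
  have hrl0 : 0 ≤ r * l := by positivity
  have hN : 0 ≤ max n 0 + max (-p) 0 := add_nonneg (le_max_right _ _) (le_max_right _ _)
  have b1 : q ^ (s * (|p + l| + |n + l|)) ≤ q ^ (r * (|p| + |n|) - l / 4) := by
    apply hmono
    have := mul_le_mul_of_nonneg_right hrs (by positivity : 0 ≤ |p + l| + |n + l|)
    nlinarith
  have b2 : q ^ (s * (|p| + |n|)) ≤ q ^ (r * (|p| + |n|) - l / 4) := by
    apply hmono
    have := mul_le_mul_of_nonneg_right hrs (by positivity : 0 ≤ |p| + |n|)
    linarith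
  have p1 : 0 ≤ q ^ (s * (|p + l| + |n + l|)) := by positivity
  have p2 : 0 ≤ q ^ (s * (|p| + |n|)) := by positivity
  have b3 : |q ^ (s * (|p + l| + |n + l|)) - q ^ (s * (|p| + |n|))| ≤
      2 * q ^ (r * (|p| + |n|) - l / 4) :=
    abs_le.2 ⟨by linarith, by linarith⟩
  calc q ^ (max n 0 + max (-p) 0) * (q ^ (l / 2) *
        |q ^ (s * (|p + l| + |n + l|)) - q ^ (s * (|p| + |n|))|)
      ≤ 1 * (q ^ (l / 2) * (2 * q ^ (r * (|p| + |n|) - l / 4))) := by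
        gcongr
        exact Real.rpow_le_one hq0.le hq1.le hN
    _ = 2 * q ^ (r * |n| + (r * |p| + l / 4)) := by
        rw [one_mul, mul_left_comm, ← Real.rpow_add hq0]
        ring_nf
    _ = _ := by rw [Real.rpow_add hq0, Real.rpow_add hq0]

/-- claim (1) in the proof of Lemma 5.1, with `l = l₁ + j`, `j : ℕ`. -/
theorem stmt1 (q : ℝ) (hq0 : 0 < q) (hq1 : q < 1) (c α : ℂ)
    (hc : ‖c‖ = 1) (hα : ‖α‖ = 1) (l₁ : ℤ) (hl₁ : 0 < l₁)
    (d : ℕ → ℂ) (hd : IsAdmissibleSeq q c l₁ d)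
    (a : ℤ → ℕ → ℂ) (ha : IsAdmissibleFam q l₁ a)
    (T : ℝ → ℤ × ℕ × ℕ → ℂ)
    (hT : ∀ (s : ℝ) (n : ℤ) (m j : ℕ),
      T s (n, m, j) = c ^ (2 * n + (m : ℤ)) * qc q ((n : ℝ) - (m : ℝ) / 2) * d m * a n m *
        (c * α) ^ (l₁ + (j : ℤ)) * qc q (((l₁ : ℝ) + (j : ℝ)) / 2) *
        (qc q (s * (((|n + (m : ℤ) + (l₁ + (j : ℤ))| : ℤ) : ℝ) +
            ((|n + (l₁ + (j : ℤ))| : ℤ) : ℝ))) -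
         qc q (s * (((|n + (m : ℤ)| : ℤ) : ℝ) + ((|n| : ℤ) : ℝ))))) :
    (∀ s : ℝ, 0 < s → Summable fun p : ℤ × ℕ × ℕ => ‖T s p‖) ∧
    Tendsto (fun s : ℝ => (s : ℂ) * ∑' p : ℤ × ℕ × ℕ, T s p)
      (𝓝[>] (0 : ℝ)) (𝓝 0) := by
  obtain ⟨C₁, hC₁, hdb⟩ := hd.exists_bound hq0 hc
  obtain ⟨C₂, hC₂, hab⟩ := ha.exists_bound hq0 hl₁
  have hl : (0 : ℝ) < l₁ := Int.cast_pos.2 hl₁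
  have hT' : ∀ (s : ℝ) (n : ℤ) (m j : ℕ), ‖T s (n, m, j)‖ ≤
      C₁ * C₂ * (q ^ (max (n : ℝ) 0 + max (-((n : ℝ) + m)) 0) * (q ^ (((l₁ : ℝ) + j) / 2) *
        |q ^ (s * (|(n : ℝ) + m + (l₁ + j)| + |(n : ℝ) + (l₁ + j)|)) -
          q ^ (s * (|(n : ℝ) + m| + |(n : ℝ)|))|)) := by
    intro s n m j
    have hcoef : q ^ ((n : ℝ) - m / 2) * ‖d m‖ * ‖a n m‖ ≤
        C₁ * C₂ * q ^ (max (n : ℝ) 0 + max (-((n : ℝ) + m)) 0) := by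
      calc q ^ ((n : ℝ) - m / 2) * ‖d m‖ * ‖a n m‖
          ≤ q ^ ((n : ℝ) - m / 2) * (C₁ * q ^ ((m : ℝ) / 2)) * ‖a n m‖ := by
            gcongr
            exact hdb m
        _ = C₁ * (q ^ (n : ℝ) * ‖a n m‖) := by
            rw [mul_left_comm, ← Real.rpow_add hq0, sub_add_cancel, mul_assoc]
        _ ≤ C₁ * (C₂ * q ^ (max (n : ℝ) 0 + max (-((n : ℝ) + m)) 0)) :=
            mul_le_mul_of_nonneg_left (hab n m) hC₁
        _ = _ := by ring
    have hdiff : ∀ x y : ℝ, ‖qc q x - qc q y‖ = |q ^ x - q ^ y| := fun x y => by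
      rw [qc, qc, ← Complex.ofReal_sub, Complex.norm_real, Real.norm_eq_abs]
    rw [hT]
    simp only [norm_mul, norm_zpow, hdiff, norm_qc hq0, hc, hα, one_zpow, mul_one, one_mul]
    push_cast
    rw [mul_assoc, ← mul_assoc (C₁ * C₂)]
    exact mul_le_mul_of_nonneg_right hcoef (by positivity)
  have hsum : ∀ s : ℝ, 0 < s → Summable fun n : ℤ => q ^ (s * |(n : ℝ)|) := fun s hs =>
    (hasSum_rpow_mul_abs hq0 hq1 hs).summable
  have hpos : ∀ s : ℝ, (0 : ℤ → ℝ) ≤ fun n : ℤ => q ^ (s * |(n : ℝ)|) := fun s n =>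
    Real.rpow_nonneg hq0.le _
  set h : ℕ → ℝ := fun j => ((l₁ : ℝ) + j) * q ^ (((l₁ : ℝ) + j) / 4) with hh
  have hhs : Summable h := summable_mul_rpow_div hq0 hq1 l₁
  have hh0 : 0 ≤ h := fun j => by simp only [hh, Pi.zero_apply]; positivity
  have hone : ∀ j : ℕ, (1 : ℝ) ≤ (l₁ : ℝ) + j := fun j => by
    have : (1 : ℝ) ≤ l₁ := by exact_mod_cast hl₁
    linarith [(Nat.cast_nonneg j : (0 : ℝ) ≤ j)]
  have hsummable : ∀ s : ℝ, 0 < s → Summable fun p : ℤ × ℕ × ℕ => ‖T s p‖ := by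
    intro s hs
    have hr : 0 < min s (1 / 8) := lt_min hs (by norm_num)
    have hS := (summable_and_tsum_le_of_mul_shear (hsum _ hr) (hsum _ hr) hhs
      (hpos _) (hpos _) hh0).1.mul_left (C₁ * C₂ * 2)
    refine Summable.of_nonneg_of_le (fun _ => norm_nonneg _) ?_ hS
    rintro ⟨n, m, j⟩
    refine (hT' s n m j).trans ?_
    rw [mul_assoc (C₁ * C₂)]
    refine mul_le_mul_of_nonneg_left ?_ (by positivity)
    refine (increment_le_of_le hq0 hq1 (by linarith [hone j]) hr (min_le_right _ _)
      (min_le_left _ _)).trans ?_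
    simp only [hh]
    push_cast
    gcongr
    exact le_mul_of_one_le_left (by positivity) (hone j)
  refine ⟨hsummable, ?_⟩
  set G : ℝ := ∑' n : ℤ, q ^ (1 / 8 * |(n : ℝ)|) with hG
  have hG0 : 0 ≤ G := tsum_nonneg (hpos _)
  have hH0 : 0 ≤ ∑' j, h j := tsum_nonneg hh0
  have hlog : 0 < -Real.log q := neg_pos.2 (Real.log_neg hq0 hq1)
  have hbound : ∀ s : ℝ, 0 < s → s ≤ 1 / 16 → ‖(s : ℂ) * ∑' p : ℤ × ℕ × ℕ, T s p‖ ≤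
      s * (C₁ * C₂ * (2 * -Real.log q) * (4 * (G * ∑' j, h j) / (1 - q))) := by
    intro s hs hs'
    have h8 : (0 : ℝ) < 1 / 8 := by norm_num
    obtain ⟨hS₁, hle₁⟩ := summable_and_tsum_le_of_mul_shear (hsum _ h8) (hsum _ hs) hhs
      (hpos _) (hpos _) hh0
    obtain ⟨hS₂, hle₂⟩ := summable_and_tsum_le_of_mul_shear (hsum _ hs) (hsum _ h8) hhs
      (hpos _) (hpos _) hh0
    have hGs := tsum_rpow_mul_abs_le hq0 hq1 hs (by linarith)
    rw [norm_mul, Complex.norm_real, Real.norm_of_nonneg hs.le]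
    refine mul_le_mul_of_nonneg_left ?_ hs.le
    calc ‖∑' p : ℤ × ℕ × ℕ, T s p‖ ≤ ∑' p : ℤ × ℕ × ℕ, ‖T s p‖ :=
          norm_tsum_le_tsum_norm (hsummable s hs)
      _ ≤ ∑' x : ℤ × ℕ × ℕ, C₁ * C₂ * (s * (2 * -Real.log q)) *
            (q ^ (1 / 8 * |(x.1 : ℝ)|) * (q ^ (s * |((x.1 + x.2.1 : ℤ) : ℝ)|) * h x.2.2) +
              q ^ (s * |(x.1 : ℝ)|) * (q ^ (1 / 8 * |((x.1 + x.2.1 : ℤ) : ℝ)|) * h x.2.2)) := by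
          refine (hsummable s hs).tsum_le_tsum ?_ ((hS₁.add hS₂).mul_left _)
          rintro ⟨n, m, j⟩
          refine (hT' s n m j).trans ?_
          rw [mul_assoc (C₁ * C₂)]
          refine mul_le_mul_of_nonneg_left ?_ (by positivity)
          simp only [hh]
          push_cast
          exact weight_mul_increment_le hq0 hq1 (by linarith [hone j]) hs hs'
      _ ≤ C₁ * C₂ * (s * (2 * -Real.log q)) *
            (G * (2 / (s * (1 - q)) * ∑' j, h j) + 2 / (s * (1 - q)) * (G * ∑' j, h j)) := by
          rw [tsum_mul_left, hS₁.tsum_add hS₂]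
          refine mul_le_mul_of_nonneg_left (add_le_add (hle₁.trans ?_) (hle₂.trans ?_))
            (by positivity)
          · gcongr
          · gcongr
      _ = C₁ * C₂ * (2 * -Real.log q) * (4 * (G * ∑' j, h j) / (1 - q)) := by
          have : 1 - q ≠ 0 := by linarith
          field_simp
          ring
  have hlim : Tendsto (fun s : ℝ =>
      s * (C₁ * C₂ * (2 * -Real.log q) * (4 * (G * ∑' j, h j) / (1 - q))))
      (𝓝[>] (0 : ℝ)) (𝓝 0) := by
    refine tendsto_nhdsWithin_of_tendsto_nhds ?_
    have hcont : Continuous fun s : ℝ =>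
        s * (C₁ * C₂ * (2 * -Real.log q) * (4 * (G * ∑' j, h j) / (1 - q))) :=
      continuous_id.mul continuous_const
    exact hcont.tendsto' 0 0 (zero_mul _)
  refine squeeze_zero_norm' ?_ hlim
  filter_upwards [Ioc_mem_nhdsGT (show (0 : ℝ) < 1 / 16 by norm_num)] with s hs
  exact hbound s hs.1 hs.2
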